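/- Let p be a prime with p ≡ 3 (mod 8). Then ∑Q − ∑N = ∑N^l − ∑Q^l, where ∑Q and ∑N are the sums in Z of all quadratic residues and all quadratic nonresidues mod p (taken among 1,...,p-1), and ∑Q^l and ∑N^l are the sums in Z of those quadratic residues and nonresidues, respectively, that are less than p/2. -/

import Mathlib

open scoped Classical

namespace Finset

/-- Pairing `a` with `2 * n + 1 - a`. -/
theorem sum_Icc_two_mul_eq_sum_add_reflect {M : Type*} [AddCommMonoid M] (g : ℕ → M) (n : ℕ) :
    ∑ a ∈ Icc 1 (2 * n), g a = ∑ a ∈ Icc 1 n, (g a + g (2 * n + 1 - a)) := by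
  rw [← sum_filter_add_sum_filter_not (Icc 1 (2 * n)) (fun a => a ≤ n), sum_add_distrib]
  congr 1
  · refine sum_congr ?_ fun _ _ => rfl
    ext a
    simp only [mem_filter, mem_Icc]
    omega
  · refine sum_nbij' (fun a => 2 * n + 1 - a) (fun a => 2 * n + 1 - a) ?_ ?_ ?_ ?_ ?_ <;>
      intro a ha <;> simp only [mem_filter, mem_Icc] at ha ⊢
    any_goals omega
    congr 1
    omega

/-- Splitting by parity, the odd numbers being written as `2 * n + 1 - 2 * a`. -/
theorem sum_Icc_two_mul_eq_sum_even_add_odd {M : Type*} [AddCommMonoid M] (g : ℕ → M) (n : ℕ) :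
    ∑ a ∈ Icc 1 (2 * n), g a = ∑ a ∈ Icc 1 n, (g (2 * a) + g (2 * n + 1 - 2 * a)) := by
  rw [← sum_filter_add_sum_filter_not (Icc 1 (2 * n)) (fun a => a % 2 = 0), sum_add_distrib]
  congr 1
  · refine sum_nbij' (fun a => a / 2) (fun a => 2 * a) ?_ ?_ ?_ ?_ ?_ <;>
      intro a ha <;> simp only [mem_filter, mem_Icc] at ha ⊢
    any_goals omega
    congr 1
    omega
  · refine sum_nbij' (fun a => (2 * n + 1 - a) / 2) (fun a => 2 * n + 1 - 2 * a) ?_ ?_ ?_ ?_ ?_ <;>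
      intro a ha <;> simp only [mem_filter, mem_Icc] at ha ⊢
    any_goals omega
    congr 1
    omega

end Finset

/-- If `χ` is odd modulo `2 * n + 1` and changes sign under doubling, then its first moments over
the full and the half range are opposite. -/
theorem sum_mul_eq_neg_sum_mul_half (χ : ℕ → ℤ) (n : ℕ)
    (hreflect : ∀ a ∈ Finset.Icc 1 (2 * n), χ (2 * n + 1 - a) = -χ a)
    (hdouble : ∀ a, χ (2 * a) = -χ a) :
    ∑ a ∈ Finset.Icc 1 (2 * n), (a : ℤ) * χ a = -∑ a ∈ Finset.Icc 1 n, (a : ℤ) * χ a := by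
  have hsum := Finset.sum_Icc_two_mul_eq_sum_add_reflect (fun a => (a : ℤ) * χ a) n
  have hparity := Finset.sum_Icc_two_mul_eq_sum_even_add_odd (fun a => (a : ℤ) * χ a) n
  have hcombine : ∑ a ∈ Finset.Icc 1 n, ((a : ℤ) * χ a + (2 * n + 1 - a : ℕ) * χ (2 * n + 1 - a)) +
      ∑ a ∈ Finset.Icc 1 n,
        ((2 * a : ℕ) * χ (2 * a) + (2 * n + 1 - 2 * a : ℕ) * χ (2 * n + 1 - 2 * a)) =
      -2 * ∑ a ∈ Finset.Icc 1 n, (a : ℤ) * χ a := by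
    rw [← Finset.sum_add_distrib, Finset.mul_sum]
    refine Finset.sum_congr rfl fun a ha => ?_
    rw [Finset.mem_Icc] at ha
    rw [hreflect a (Finset.mem_Icc.2 (by omega)), hreflect (2 * a) (Finset.mem_Icc.2 (by omega)),
      hdouble, Nat.cast_sub (by omega), Nat.cast_sub (by omega)]
    push_cast
    ring
  linarith

/-- The sum of the squares minus the sum of the nonsquares, as a character sum. -/
theorem sum_isSquare_sub_sum_not_isSquare (p : ℕ) [Fact p.Prime] (s : Finset ℕ)
    (hs : ∀ a ∈ s, (a : ZMod p) ≠ 0) :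
    (∑ a ∈ s.filter (fun a : ℕ => IsSquare (a : ZMod p)), (a : ℤ)) -
      (∑ a ∈ s.filter (fun a : ℕ => ¬ IsSquare (a : ZMod p)), (a : ℤ)) =
    ∑ a ∈ s, (a : ℤ) * legendreSym p a := by
  rw [Finset.sum_filter, Finset.sum_filter, ← Finset.sum_sub_distrib]
  refine Finset.sum_congr rfl fun a ha => ?_
  by_cases hsq : IsSquare (a : ZMod p)
  · simp [hsq, (legendreSym.eq_one_iff' p (hs a ha)).2 hsq]
  · simp [hsq, (legendreSym.eq_neg_one_iff' p).2 hsq]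

/-- If `p` is a prime with `p ≡ 3 (mod 8)`, then `∑Q − ∑N = ∑Nˡ − ∑Qˡ`, where
`Q`, `N` are the quadratic residues and nonresidues mod `p` among `1, …, p-1`,
and `Qˡ`, `Nˡ` are those less than `p/2`; all sums taken in `ℤ`. -/
theorem sum_residues_sub_sum_nonresidues_eq
    (p : ℕ) (hp : p.Prime) (h : p % 8 = 3) :
    (∑ a ∈ (Finset.Icc 1 (p - 1)).filter
        (fun a : ℕ => IsSquare (a : ZMod p)), (a : ℤ)) -
    (∑ a ∈ (Finset.Icc 1 (p - 1)).filter
        (fun a : ℕ => ¬ IsSquare (a : ZMod p)), (a : ℤ)) =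
    (∑ a ∈ (Finset.Icc 1 (p - 1)).filter
        (fun a : ℕ => ¬ IsSquare (a : ZMod p) ∧ 2 * a < p), (a : ℤ)) -
    (∑ a ∈ (Finset.Icc 1 (p - 1)).filter
        (fun a : ℕ => IsSquare (a : ZMod p) ∧ 2 * a < p), (a : ℤ)) := by
  have := Fact.mk hp
  obtain ⟨n, rfl⟩ : ∃ n, p = 2 * n + 1 := ⟨p / 2, by omega⟩
  have hp2 : 2 * n + 1 ≠ 2 := by omega
  have hne : ∀ a ∈ Finset.Icc 1 (2 * n), (a : ZMod (2 * n + 1)) ≠ 0 := fun a ha h0 => by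
    rw [Finset.mem_Icc] at ha
    have := Nat.le_of_dvd (by omega) ((ZMod.natCast_eq_zero_iff _ _).1 h0)
    omega
  have hneg : legendreSym (2 * n + 1) (-1) = -1 := by
    rw [legendreSym.at_neg_one hp2, ZMod.χ₄_nat_three_mod_four (by omega)]
  have htwo : legendreSym (2 * n + 1) 2 = -1 := by
    rw [legendreSym.at_two hp2, ZMod.χ₈_nat_mod_eight, h]
    decide
  have hmoment := sum_mul_eq_neg_sum_mul_half (fun a => legendreSym (2 * n + 1) a) n
    (fun a ha => by
      rw [← neg_one_mul, ← hneg, ← legendreSym.mul, legendreSym.mod,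
        legendreSym.mod _ (-1 * (a : ℤ)), Nat.cast_sub (by rw [Finset.mem_Icc] at ha; omega),
        sub_eq_add_neg, Int.add_emod_left, neg_one_mul])
    (fun a => by rw [← neg_one_mul, ← htwo, ← legendreSym.mul, Nat.cast_mul, Nat.cast_ofNat])
  have hhalf : (Finset.Icc 1 (2 * n)).filter (fun a => 2 * a < 2 * n + 1) = Finset.Icc 1 n := by
    ext a
    simp only [Finset.mem_filter, Finset.mem_Icc]
    omega
  have hlow := sum_isSquare_sub_sum_not_isSquare (2 * n + 1) (Finset.Icc 1 n)
    fun a ha => hne a (Finset.Icc_subset_Icc_right (by omega) ha)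
  rw [← hhalf, Finset.filter_filter, Finset.filter_filter, hhalf] at hlow
  simp only [and_comm (a := 2 * _ < 2 * n + 1)] at hlow
  have hfull := sum_isSquare_sub_sum_not_isSquare (2 * n + 1) (Finset.Icc 1 (2 * n)) hne
  rw [hmoment, ← hlow, neg_sub] at hfull
  rw [Nat.add_sub_cancel]
  convert hfull
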